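/- arXiv:math/0007050 — 5 statements merged into one kernel-verified Lean document; each statement's English description precedes it below -/
import Mathlib

section
/- Let k, ε ∈ ℝ² with k ≠ 0, ⟨k,ε⟩ ≠ 0 and k × ε ≠ 0. Then there exists δ > 0 such that for every real t with 0 < |t| < δ there exists α₀ > 0 such that for every α > α₀ the sectional curvature C(α, k, k+t·ε) = ρ²(α, k, k+t·ε)·B̃(α², k, k+t·ε) is strictly positive. -/
noncomputable section

/-- Squared Euclidean norm of a vector in ℝ². -/
def nsq (k : ℝ × ℝ) : ℝ := k.1 ^ 2 + k.2 ^ 2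

/-- A_x(k) = ‖k‖²·(1 + x·‖k‖²). -/
def A (x : ℝ) (k : ℝ × ℝ) : ℝ := nsq k * (1 + x * nsq k)

/-- A^α(k) = A_{α²}(k). -/
def Aa (α : ℝ) (k : ℝ × ℝ) : ℝ := A (α ^ 2) k

/-- Cross product k × l = k₁l₂ − k₂l₁. -/
def cross (k l : ℝ × ℝ) : ℝ := k.1 * l.2 - k.2 * l.1

/-- Euclidean inner product ⟨k,l⟩ = k₁l₁ + k₂l₂. -/
def inner2 (k l : ℝ × ℝ) : ℝ := k.1 * l.1 + k.2 * l.2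

/-- The curvature bracket B̃(x,k,l). -/
def Bbr (x : ℝ) (k l : ℝ × ℝ) : ℝ :=
  A x (k + l) * A x (k - l) *
      (4 * A x k + 4 * A x l - 3 * A x (k + l) - 3 * A x (k - l)) +
    (A x k - A x l) ^ 2 * (A x (k + l) + A x (k - l))

/-- ρ²(α,k,l) = S·(k×l)²/(36·A^α(k+l)·A^α(k−l)), with S = 4π². -/
def rhoSq (α : ℝ) (k l : ℝ × ℝ) : ℝ :=
  4 * Real.pi ^ 2 * cross k l ^ 2 / (36 * Aa α (k + l) * Aa α (k - l))

/-- Sectional curvature C(α,k,l) = ρ²(α,k,l)·B̃(α²,k,l). -/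
def C (α : ℝ) (k l : ℝ × ℝ) : ℝ := rhoSq α k l * Bbr (α ^ 2) k l

/-- Taylor coefficients at x = 0 of x ↦ B̃(x,k,l). -/
def bcoef (i : ℕ) (k l : ℝ × ℝ) : ℝ :=
  (1 / (Nat.factorial i : ℝ)) * iteratedDeriv i (fun x => Bbr x k l) 0

theorem exists_forall_gt_cubic_pos (c₀ c₁ c₂ c₃ : ℝ) (h : 0 < c₃) :
    ∃ X > 0, ∀ x : ℝ, x > X → 0 < c₀ + c₁ * x + c₂ * x ^ 2 + c₃ * x ^ 3 := by
  refine ⟨1 + (|c₀| + |c₁| + |c₂|) / c₃, by positivity, fun x hx => ?_⟩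
  have hfrac : 0 ≤ (|c₀| + |c₁| + |c₂|) / c₃ := by positivity
  have hx1 : 1 < x := by linarith
  have hx2 : 1 ≤ x ^ 2 := by nlinarith
  have hxx : x ≤ x ^ 2 := by nlinarith
  have hc : |c₀| + |c₁| + |c₂| < c₃ * x := by
    have : (|c₀| + |c₁| + |c₂|) / c₃ < x := by linarith
    rw [div_lt_iff₀ h] at this
    linarith
  have h₀ : -(|c₀| * x ^ 2) ≤ c₀ := by
    nlinarith [neg_abs_le c₀, abs_nonneg c₀]
  have h₁ : -(|c₁| * x ^ 2) ≤ c₁ * x := by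
    nlinarith [neg_abs_le c₁, abs_nonneg c₁]
  have h₂ : -(|c₂| * x ^ 2) ≤ c₂ * x ^ 2 := by
    nlinarith [neg_abs_le c₂]
  have h₃ : (|c₀| + |c₁| + |c₂|) * x ^ 2 < c₃ * x * x ^ 2 := by gcongr
  linarith [show c₃ * x * x ^ 2 = c₃ * x ^ 3 by ring]

/-- The coefficient of `x ^ 3` in the curvature bracket. -/
def bracketLead (k l : ℝ × ℝ) : ℝ :=
  nsq (k + l) ^ 2 * nsq (k - l) ^ 2 *
      (4 * nsq k ^ 2 + 4 * nsq l ^ 2 - 3 * nsq (k + l) ^ 2 - 3 * nsq (k - l) ^ 2) +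
    (nsq k ^ 2 - nsq l ^ 2) ^ 2 * (nsq (k + l) ^ 2 + nsq (k - l) ^ 2)

theorem Bbr_eq_cubic (k l : ℝ × ℝ) :
    ∃ c₀ c₁ c₂ : ℝ, ∀ x, Bbr x k l = c₀ + c₁ * x + c₂ * x ^ 2 + bracketLead k l * x ^ 3 := by
  unfold Bbr bracketLead A
  generalize nsq k = a, nsq l = b, nsq (k + l) = p, nsq (k - l) = m
  refine ⟨p * m * (4 * a + 4 * b - 3 * p - 3 * m) + (a - b) ^ 2 * (p + m),
    p * m * (4 * a ^ 2 + 4 * b ^ 2 - 3 * p ^ 2 - 3 * m ^ 2 +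
        (p + m) * (4 * a + 4 * b - 3 * p - 3 * m)) +
      (a - b) ^ 2 * (p ^ 2 + m ^ 2 + 2 * (a + b) * (p + m)),
    p * m * ((p + m) * (4 * a ^ 2 + 4 * b ^ 2 - 3 * p ^ 2 - 3 * m ^ 2) +
        p * m * (4 * a + 4 * b - 3 * p - 3 * m)) +
      (a - b) ^ 2 * (2 * (a + b) * (p ^ 2 + m ^ 2) + (a + b) ^ 2 * (p + m)),
    fun x => by ring⟩

theorem nsq_pos {k : ℝ × ℝ} (hk : k ≠ 0) : 0 < nsq k := by
  unfold nsq
  by_contra! h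
  exact hk (Prod.ext (by simp; nlinarith [sq_nonneg k.1, sq_nonneg k.2])
    (by simp; nlinarith [sq_nonneg k.1, sq_nonneg k.2]))

theorem A_pos {x : ℝ} (hx : 0 ≤ x) {k : ℝ × ℝ} (hk : 0 < nsq k) : 0 < A x k := by
  unfold A
  positivity

theorem nsq_add_smul (k ε : ℝ × ℝ) (t : ℝ) :
    nsq (k + t • ε) = nsq k + 2 * t * inner2 k ε + t ^ 2 * nsq ε := by
  simp [nsq, inner2]; ring

theorem nsq_add_add_smul (k ε : ℝ × ℝ) (t : ℝ) :
    nsq (k + (k + t • ε)) = 4 * nsq k + 4 * t * inner2 k ε + t ^ 2 * nsq ε := by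
  simp [nsq, inner2]; ring

theorem nsq_sub_add_smul (k ε : ℝ × ℝ) (t : ℝ) :
    nsq (k - (k + t • ε)) = t ^ 2 * nsq ε := by
  simp [nsq]; ring

theorem cross_add_smul (k ε : ℝ × ℝ) (t : ℝ) : cross k (k + t • ε) = t * cross k ε := by
  simp [cross]; ring

open Topology in
theorem eventually_pos_of_continuous {f : ℝ → ℝ} (h : 0 < f 0) (hf : Continuous f) :
    ∀ᶠ t in 𝓝 0, 0 < f t :=
  (hf.tendsto 0).eventually_const_lt h

open Topology in
theorem eventually_bracketLead_pos {k ε : ℝ × ℝ} (hk : k ≠ 0) (hke : inner2 k ε ≠ 0) :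
    ∀ᶠ t : ℝ in 𝓝 0, t ≠ 0 → 0 < bracketLead k (k + t • ε) := by
  have ha := nsq_pos hk
  have hlead (t : ℝ) : bracketLead k (k + t • ε) = t ^ 2 *
      (t ^ 2 * nsq ε ^ 2 * nsq (k + (k + t • ε)) ^ 2 *
        (4 * nsq k ^ 2 + 4 * nsq (k + t • ε) ^ 2 - 3 * nsq (k + (k + t • ε)) ^ 2
          - 3 * nsq (k - (k + t • ε)) ^ 2) +
        (2 * inner2 k ε + t * nsq ε) ^ 2 * (nsq k + nsq (k + t • ε)) ^ 2 *
          (nsq (k + (k + t • ε)) ^ 2 + nsq (k - (k + t • ε)) ^ 2)) := by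
    simp only [bracketLead, nsq_add_smul, nsq_add_add_smul, nsq_sub_add_smul]
    ring
  simp only [hlead, nsq_add_smul, nsq_add_add_smul, nsq_sub_add_smul]
  have hcont := eventually_pos_of_continuous (f := fun t : ℝ =>
      t ^ 2 * nsq ε ^ 2 * (4 * nsq k + 4 * t * inner2 k ε + t ^ 2 * nsq ε) ^ 2 *
        (4 * nsq k ^ 2 + 4 * (nsq k + 2 * t * inner2 k ε + t ^ 2 * nsq ε) ^ 2
          - 3 * (4 * nsq k + 4 * t * inner2 k ε + t ^ 2 * nsq ε) ^ 2
          - 3 * (t ^ 2 * nsq ε) ^ 2) +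
        (2 * inner2 k ε + t * nsq ε) ^ 2 *
          (nsq k + (nsq k + 2 * t * inner2 k ε + t ^ 2 * nsq ε)) ^ 2 *
          ((4 * nsq k + 4 * t * inner2 k ε + t ^ 2 * nsq ε) ^ 2 + (t ^ 2 * nsq ε) ^ 2))
    (by simp; positivity) (by fun_prop)
  filter_upwards [hcont] with t ht ht0
  exact mul_pos (by positivity) ht

open Topology in
theorem eventually_nsq_add_pos {k : ℝ × ℝ} (hk : k ≠ 0) (ε : ℝ × ℝ) :
    ∀ᶠ t : ℝ in 𝓝 0, 0 < nsq (k + (k + t • ε)) := by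
  have ha := nsq_pos hk
  simp only [nsq_add_add_smul]
  exact eventually_pos_of_continuous (by simpa using ha) (by fun_prop)

/-- for k ≠ 0 with ⟨k,ε⟩ ≠ 0 and k × ε ≠ 0, for all sufficiently small
nonzero t the sectional curvature C(α, k, k + t·ε) is positive for all large α. -/
theorem stmt0 (k ε : ℝ × ℝ) (hk : k ≠ 0) (hke : inner2 k ε ≠ 0)
    (hcr : cross k ε ≠ 0) :
    ∃ δ > 0, ∀ t : ℝ, 0 < |t| → |t| < δ →
      ∃ α₀ > 0, ∀ α : ℝ, α > α₀ → 0 < C α k (k + t • ε) := by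
  have hε : ε ≠ 0 := by
    rintro rfl
    simp [cross] at hcr
  have he := nsq_pos hε
  obtain ⟨δ, hδ, h⟩ := Metric.eventually_nhds_iff.mp
    ((eventually_bracketLead_pos hk hke).and (eventually_nsq_add_pos hk ε))
  refine ⟨δ, hδ, fun t ht htδ => ?_⟩
  have ht0 : t ≠ 0 := abs_pos.mp ht
  obtain ⟨hlead, hadd⟩ := h (y := t) (by simpa using htδ)
  have hsub : 0 < nsq (k - (k + t • ε)) := by
    rw [nsq_sub_add_smul]
    positivity
  obtain ⟨c₀, c₁, c₂, hB⟩ := Bbr_eq_cubic k (k + t • ε)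
  obtain ⟨X, hX, hpos⟩ := exists_forall_gt_cubic_pos c₀ c₁ c₂ _ (hlead ht0)
  refine ⟨1 + X, by positivity, fun α hα => ?_⟩
  have hx : α ^ 2 > X := by nlinarith
  have hA₁ : 0 < Aa α (k + (k + t • ε)) := A_pos (sq_nonneg α) hadd
  have hA₂ : 0 < Aa α (k - (k + t • ε)) := A_pos (sq_nonneg α) hsub
  have hcross : cross k (k + t • ε) ≠ 0 := by
    rw [cross_add_smul]
    exact mul_ne_zero ht0 hcr
  have hρ : 0 < rhoSq α k (k + t • ε) := by
    unfold rhoSq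
    have := Real.pi_pos
    positivity
  exact mul_pos hρ (hB _ ▸ hpos _ hx)
end
end

section
/- For all k, l ∈ ℝ²: B̃(0,k,l) ≤ 0. Consequently, for α = 0 (i.e., the right-invariant L² metric) and for all k, l with k + l ≠ 0 and k − l ≠ 0, the sectional curvature C(0,k,l) = ρ²(0,k,l)·B̃(0,k,l) in the plane of the stream functions cos⟨k,x⟩ and cos⟨l,x⟩ is nonpositive (Arnold's nonpositivity result for the L² metric). -/
noncomputable section

/-- At `x = 0` the curvature bracket is a nonpositive multiple of the squared cross product. -/
theorem Bbr_zero_eq (k l : ℝ × ℝ) :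
    Bbr 0 k l = -(8 * (nsq k + nsq l) * cross k l ^ 2) := by
  simp only [Bbr, A, nsq, cross, Prod.fst_add, Prod.snd_add, Prod.fst_sub, Prod.snd_sub]
  ring

theorem nsq_nonneg (k : ℝ × ℝ) : 0 ≤ nsq k := by
  unfold nsq
  positivity

theorem Bbr_zero_nonpos (k l : ℝ × ℝ) : Bbr 0 k l ≤ 0 := by
  rw [Bbr_zero_eq, neg_nonpos]
  have := nsq_nonneg k
  have := nsq_nonneg l
  positivity

theorem rhoSq_nonneg (α : ℝ) (k l : ℝ × ℝ) : 0 ≤ rhoSq α k l := by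
  have := nsq_nonneg (k + l)
  have := nsq_nonneg (k - l)
  unfold rhoSq Aa A
  positivity

/-- B̃(0,k,l) ≤ 0, hence at α = 0 (the L² metric) the sectional
curvature C(0,k,l) is nonpositive whenever k+l ≠ 0 and k−l ≠ 0. -/
theorem stmt9 (k l : ℝ × ℝ) :
    Bbr 0 k l ≤ 0 ∧ (k + l ≠ 0 → k - l ≠ 0 → C 0 k l ≤ 0) := by
  refine ⟨Bbr_zero_nonpos k l, fun _ _ => mul_nonpos_of_nonneg_of_nonpos (rhoSq_nonneg 0 k l) ?_⟩
  rw [zero_pow two_ne_zero]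
  exact Bbr_zero_nonpos k l
end
end

section
/- Let k, l ∈ ℝ² with (k,l) ≠ (0,0). Then B̃(0,k,l) = 0 if and only if k × l = 0. (Together with the nonpositivity of B̃(0,k,l), this recovers Arnold's result that for the L² metric the sectional curvature in the plane of cos⟨k,x⟩ and cos⟨l,x⟩ is strictly negative except in the degenerate directions where k and l are parallel.) -/
noncomputable section

theorem nsq_eq_zero_iff (k : ℝ × ℝ) : nsq k = 0 ↔ k = 0 := by
  rw [nsq, add_eq_zero_iff_of_nonneg (sq_nonneg _) (sq_nonneg _), sq_eq_zero_iff,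
    sq_eq_zero_iff, Prod.ext_iff]
  rfl

theorem Bbr_zero (k l : ℝ × ℝ) :
    Bbr 0 k l = -8 * (nsq k + nsq l) * cross k l ^ 2 := by
  simp only [Bbr, A, nsq, cross, Prod.fst_add, Prod.snd_add, Prod.fst_sub, Prod.snd_sub]
  ring

/-- for (k,l) ≠ (0,0), B̃(0,k,l) = 0 iff k × l = 0. -/
theorem stmt10 (k l : ℝ × ℝ) (h : (k, l) ≠ (0, 0)) :
    Bbr 0 k l = 0 ↔ cross k l = 0 := by
  have hkl : nsq k + nsq l ≠ 0 := by
    rwa [Ne, add_eq_zero_iff_of_nonneg (nsq_nonneg k) (nsq_nonneg l), nsq_eq_zero_iff,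
      nsq_eq_zero_iff, ← Prod.mk_inj]
  simp [Bbr_zero, hkl]
end
end

section
/- Fix k, ε ∈ ℝ². Then the function t ↦ b₃(k, k + t·ε) − 256·‖k‖⁸·⟨k,ε⟩²·t² is big-O of t³ as t → 0 (with respect to the neighborhood filter at 0 on ℝ); i.e., the leading behavior of the top coefficient of the curvature bracket along l = k + t·ε is b₃ = 256·‖k‖⁸·⟨k,ε⟩²·t² + O(t³). -/
noncomputable section

/-- The third derivative at `0` of a cubic polynomial function is `6` times its top coefficient. -/
lemma iteratedDeriv_three_cubic (a b c d : ℝ) :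
    iteratedDeriv 3 (fun x : ℝ => a + b * x + c * x ^ 2 + d * x ^ 3) 0 = 6 * d := by
  have h₁ : deriv (fun x : ℝ => a + b * x + c * x ^ 2 + d * x ^ 3) =
      fun x => b + 2 * c * x + 3 * d * x ^ 2 := by
    funext x
    have h := ((((hasDerivAt_id x).const_mul b).const_add a).add
      ((hasDerivAt_pow 2 x).const_mul c)).add ((hasDerivAt_pow 3 x).const_mul d)
    refine (h.congr_deriv ?_).deriv
    norm_num
    ring
  have h₂ : deriv (fun x : ℝ => b + 2 * c * x + 3 * d * x ^ 2) =
      fun x => 2 * c + 6 * d * x := by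
    funext x
    have h := (((hasDerivAt_id x).const_mul (2 * c)).const_add b).add
      ((hasDerivAt_pow 2 x).const_mul (3 * d))
    refine (h.congr_deriv ?_).deriv
    norm_num
    ring
  have h₃ : deriv (fun x : ℝ => 2 * c + 6 * d * x) = fun _ => 6 * d := by
    funext x
    have h := ((hasDerivAt_id x).const_mul (6 * d)).const_add (2 * c)
    exact (h.congr_deriv (mul_one _)).deriv
  rw [iteratedDeriv_eq_iterate]
  simp only [Function.iterate_succ, Function.iterate_zero, Function.comp_apply, id, h₁, h₂, h₃]

lemma bcoef_three (k l : ℝ × ℝ) :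
    bcoef 3 k l =
      nsq (k + l) ^ 2 * nsq (k - l) ^ 2 *
          (4 * nsq k ^ 2 + 4 * nsq l ^ 2 - 3 * nsq (k + l) ^ 2 - 3 * nsq (k - l) ^ 2) +
        (nsq k ^ 2 - nsq l ^ 2) ^ 2 * (nsq (k + l) ^ 2 + nsq (k - l) ^ 2) := by
  generalize hp : nsq (k + l) = p
  generalize hm : nsq (k - l) = m
  generalize hu : nsq k = u
  generalize hv : nsq l = v
  have h : (fun x => Bbr x k l) = fun x : ℝ =>
      (p * m * (4 * u + 4 * v - 3 * p - 3 * m) + (u - v) ^ 2 * (p + m)) +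
      (p * m * (p + m) * (4 * u + 4 * v - 3 * p - 3 * m) +
        p * m * (4 * u ^ 2 + 4 * v ^ 2 - 3 * p ^ 2 - 3 * m ^ 2) +
        2 * (u - v) * (u ^ 2 - v ^ 2) * (p + m) + (u - v) ^ 2 * (p ^ 2 + m ^ 2)) * x +
      (p ^ 2 * m ^ 2 * (4 * u + 4 * v - 3 * p - 3 * m) +
        p * m * (p + m) * (4 * u ^ 2 + 4 * v ^ 2 - 3 * p ^ 2 - 3 * m ^ 2) +
        (u ^ 2 - v ^ 2) ^ 2 * (p + m) +
        2 * (u - v) * (u ^ 2 - v ^ 2) * (p ^ 2 + m ^ 2)) * x ^ 2 +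
      (p ^ 2 * m ^ 2 * (4 * u ^ 2 + 4 * v ^ 2 - 3 * p ^ 2 - 3 * m ^ 2) +
        (u ^ 2 - v ^ 2) ^ 2 * (p ^ 2 + m ^ 2)) * x ^ 3 := by
    funext x
    simp only [Bbr, A, hp, hm, hu, hv]
    ring
  rw [bcoef, h, iteratedDeriv_three_cubic]
  simp only [Nat.factorial]
  push_cast
  ring

/-- b₃(k, k+t·ε) = 256·‖k‖⁸·⟨k,ε⟩²·t² + O(t³) as t → 0. -/
theorem stmt12 (k ε : ℝ × ℝ) :
    (fun t : ℝ =>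
        bcoef 3 k (k + t • ε) - 256 * nsq k ^ 4 * inner2 k ε ^ 2 * t ^ 2) =O[nhds 0]
      fun t : ℝ => t ^ 3 := by
  have hL (t : ℝ) : nsq (k + t • ε) = nsq k + t * (2 * inner2 k ε + t * nsq ε) := by
    simp only [nsq, inner2, Prod.fst_add, Prod.snd_add, Prod.smul_fst, Prod.smul_snd, smul_eq_mul]
    ring
  have hP (t : ℝ) : nsq (k + (k + t • ε)) = 4 * nsq k + t * (4 * inner2 k ε + t * nsq ε) := by
    simp only [nsq, inner2, Prod.fst_add, Prod.snd_add, Prod.smul_fst, Prod.smul_snd, smul_eq_mul]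
    ring
  have hM (t : ℝ) : nsq (k - (k + t • ε)) = t ^ 2 * nsq ε := by
    simp only [nsq, Prod.fst_sub, Prod.snd_sub, Prod.fst_add, Prod.snd_add, Prod.smul_fst,
      Prod.smul_snd, smul_eq_mul]
    ring
  simp only [bcoef_three, hL, hP, hM]
  generalize nsq k = K
  generalize nsq ε = E
  generalize inner2 k ε = I
  let b : ℝ → ℝ := fun t => 2 * I + t * E
  let c : ℝ → ℝ := fun t => 4 * I + t * E
  let q : ℝ → ℝ := fun t => 8 * K ^ 2 * E + b t * (2 * K * c t + 4 * K * b t + t * b t * c t)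
  let g : ℝ → ℝ := fun t =>
    t * E ^ 2 * (4 * K + t * c t) ^ 2 *
        (4 * K ^ 2 + 4 * (K + t * b t) ^ 2 - 3 * (4 * K + t * c t) ^ 2 - 3 * (t ^ 2 * E) ^ 2) +
      t ^ 3 * E ^ 2 * b t ^ 2 * (2 * K + t * b t) ^ 2 + q t * (32 * I * K ^ 2 + t * q t)
  have hg : Continuous g := by fun_prop
  have hO : (fun t => t ^ 3 * g t) =O[nhds 0] fun t : ℝ => t ^ 3 := by
    simpa using (Asymptotics.isBigO_refl (fun t : ℝ => t ^ 3) (nhds 0)).mul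
      ((hg.tendsto 0).isBigO_one ℝ)
  refine hO.congr_left fun t => ?_
  simp only [g, q, b, c]
  ring
end
end

section
/- Fix k, ε ∈ ℝ². Then the function t ↦ b₀(k, k + t·ε) + 16·‖k‖²·(k × ε)²·t² is big-O of t³ as t → 0 (with respect to the neighborhood filter at 0 on ℝ); i.e., along l = k + t·ε the constant coefficient of the curvature bracket satisfies b₀ = (16·‖k‖²·⟨k,ε⟩² − 16·‖k‖⁴·‖ε‖²)·t² + O(t³) = −16·‖k‖²·(k × ε)²·t² + O(t³). -/
noncomputable section

/-- At `x = 0` the curvature bracket factors through the squared cross product. -/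
theorem bcoef_zero (k l : ℝ × ℝ) :
    bcoef 0 k l = -8 * (nsq k + nsq l) * cross k l ^ 2 := by
  simp only [bcoef, iteratedDeriv_zero, Nat.factorial_zero, Nat.cast_one, Bbr, A, nsq, cross,
    Prod.fst_add, Prod.snd_add, Prod.fst_sub, Prod.snd_sub]
  ring

/-- b₀(k, k+t·ε) = −16·‖k‖²·(k×ε)²·t² + O(t³) as t → 0. -/
theorem stmt13 (k ε : ℝ × ℝ) :
    (fun t : ℝ =>
        bcoef 0 k (k + t • ε) + 16 * nsq k * cross k ε ^ 2 * t ^ 2) =O[nhds 0]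
      fun t : ℝ => t ^ 3 := by
  have key : (fun t : ℝ =>
      bcoef 0 k (k + t • ε) + 16 * nsq k * cross k ε ^ 2 * t ^ 2) =
      fun t : ℝ => (-8 * cross k ε ^ 2 * (2 * inner2 k ε + t * nsq ε)) * t ^ 3 := by
    funext t
    simp only [bcoef_zero, nsq, cross, inner2, Prod.fst_add, Prod.snd_add, Prod.smul_fst,
      Prod.smul_snd, smul_eq_mul]
    ring
  have hcont : Continuous fun t : ℝ =>
      -8 * cross k ε ^ 2 * (2 * inner2 k ε + t * nsq ε) := by fun_prop
  rw [key]
  simpa only [one_mul] using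
    ((hcont.tendsto 0).isBigO_one ℝ).mul (Asymptotics.isBigO_refl (fun t : ℝ => t ^ 3) (nhds 0))
end
end
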